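/- Let 𝒜 be an abelian category and 𝒞 a full additive subcategory with 𝒞⊥𝒞, and let A be an object of 𝒜 with 𝒢(𝒞)-dim A < ∞. Then 𝒢(𝒞)-dim A = ^⊥𝒞-dim A. -/

import Mathlib

open CategoryTheory CategoryTheory.Limits CategoryTheory.Abelian ZeroObject

universe w v u

namespace RelHomDim

variable {𝒜 : Type u} [Category.{v} 𝒜] [Abelian 𝒜]

/-- A class of objects of an abelian category corresponding to a full additive
subcategory: it is closed under isomorphisms, contains a zero object and is
closed under finite direct sums (biproducts). -/
def IsAdditiveClass (P : 𝒜 → Prop) : Prop :=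
  P 0 ∧ (∀ ⦃X Y : 𝒜⦄, (X ≅ Y) → P X → P Y) ∧ ∀ ⦃X Y : 𝒜⦄, P X → P Y → P (X ⊞ Y)

/-- A class of objects is closed under direct summands. -/
def ClosedUnderSummands (P : 𝒜 → Prop) : Prop :=
  ∀ X Y : 𝒜, P (X ⊞ Y) → P X ∧ P Y

/-- `Hom(W,-)`-exactness of a short exact sequence `0 → X₁ → X₂ → X₃ → 0`:
the induced sequence `0 → Hom(W,X₁) → Hom(W,X₂) → Hom(W,X₃) → 0` is exact. -/
def CovHomExact (W : 𝒜) (S : ShortComplex 𝒜) : Prop :=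
  (∀ a b : W ⟶ S.X₁, a ≫ S.f = b ≫ S.f → a = b) ∧
  (∀ b : W ⟶ S.X₂, b ≫ S.g = 0 → ∃ a : W ⟶ S.X₁, a ≫ S.f = b) ∧
  (∀ c : W ⟶ S.X₃, ∃ b : W ⟶ S.X₂, b ≫ S.g = c)

/-- A short exact sequence is `ℰ`-proper (i.e. `Hom(ℰ,-)`-exact) if it is
`Hom(E,-)`-exact for every object `E` in the class `ℰ`. -/
def EProper (E : 𝒜 → Prop) (S : ShortComplex 𝒜) : Prop :=
  ∀ W, E W → CovHomExact W S

/-- `ResW P W n K A` holds iff there is an exact sequence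
`0 → K → X_{n-1} → ⋯ → X_0 → A → 0` in `𝒜` with all the `n` middle terms `X i`
in `P`, such that each of the short exact sequences obtained by splicing
satisfies `W` (this encodes, e.g., `Hom(ℰ,-)`-exactness of the whole sequence). -/
def ResW (P : 𝒜 → Prop) (W : ShortComplex 𝒜 → Prop) : ℕ → 𝒜 → 𝒜 → Prop
  | 0 => fun K A => Nonempty (K ≅ A)
  | n + 1 => fun K A => ∃ (B X : 𝒜) (f : B ⟶ X) (g : X ⟶ A) (w : f ≫ g = 0),
      P X ∧ (ShortComplex.mk f g w).ShortExact ∧ W (ShortComplex.mk f g w) ∧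
      ResW P W n K B

/-- `Res P n K A` : there is an exact sequence `0 → K → X_{n-1} → ⋯ → X_0 → A → 0`
with all middle terms in `P`. -/
abbrev Res (P : 𝒜 → Prop) : ℕ → 𝒜 → 𝒜 → Prop := ResW P fun _ => True

/-- `CoresW P W n A K` holds iff there is an exact sequence
`0 → A → X^0 → ⋯ → X^{n-1} → K → 0` with all middle terms in `P` and each
spliced short exact piece satisfying `W`. -/
def CoresW (P : 𝒜 → Prop) (W : ShortComplex 𝒜 → Prop) : ℕ → 𝒜 → 𝒜 → Prop
  | 0 => fun A K => Nonempty (A ≅ K)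
  | n + 1 => fun A K => ∃ (X B : 𝒜) (f : A ⟶ X) (g : X ⟶ B) (w : f ≫ g = 0),
      P X ∧ (ShortComplex.mk f g w).ShortExact ∧ W (ShortComplex.mk f g w) ∧
      CoresW P W n B K

/-- `Cores P n A K` : there is an exact sequence `0 → A → X^0 → ⋯ → X^{n-1} → K → 0`
with all middle terms in `P`. -/
abbrev Cores (P : 𝒜 → Prop) : ℕ → 𝒜 → 𝒜 → Prop := CoresW P fun _ => True

/-- The `P`-dimension of `A` : the infimum of the `n ≥ 0` such that there is
an exact sequence `0 → C_n → ⋯ → C_1 → C_0 → A → 0` with all `C_i` in `P`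
(`⊤ = ∞` if there is no such `n`). -/
noncomputable def rdim (P : 𝒜 → Prop) (A : 𝒜) : ℕ∞ :=
  sInf {c : ℕ∞ | ∃ n : ℕ, c = n ∧ ∃ K, P K ∧ Res P n K A}

/-- The `P`-codimension of `A` : the infimum of the `n ≥ 0` such that there is
an exact sequence `0 → A → C^0 → C^1 → ⋯ → C^n → 0` with all `C^i` in `P`
(`⊤ = ∞` if there is no such `n`). -/
noncomputable def rcodim (P : 𝒜 → Prop) (A : 𝒜) : ℕ∞ :=
  sInf {c : ℕ∞ | ∃ n : ℕ, c = n ∧ ∃ K, P K ∧ Cores P n A K}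

/-- `A` belongs to `P^⊥`, i.e. `Ext^i(C, A) = 0` for all `C` in `P` and `i ≥ 1`. -/
def MemRightPerp [HasExt.{w} 𝒜] (P : 𝒜 → Prop) (A : 𝒜) : Prop :=
  ∀ C, P C → ∀ i : ℕ, 1 ≤ i → Subsingleton (Abelian.Ext C A i)

/-- `A` belongs to `^⊥P`, i.e. `Ext^i(A, C) = 0` for all `C` in `P` and `i ≥ 1`. -/
def MemLeftPerp [HasExt.{w} 𝒜] (P : 𝒜 → Prop) (A : 𝒜) : Prop :=
  ∀ C, P C → ∀ i : ℕ, 1 ≤ i → Subsingleton (Abelian.Ext A C i)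

/-- `𝒞` is an `ℰ`-proper generator for `𝒯` (`𝒞 ⊆ 𝒯` and every object of `𝒯`
is an `ℰ`-proper quotient of an object of `𝒞` with kernel in `𝒯`). -/
def IsProperGenerator (E C T : 𝒜 → Prop) : Prop :=
  (∀ ⦃X⦄, C X → T X) ∧
  ∀ X, T X → ∃ (X' Cb : 𝒜) (f : X' ⟶ Cb) (g : Cb ⟶ X) (w : f ≫ g = 0),
    C Cb ∧ T X' ∧ (ShortComplex.mk f g w).ShortExact ∧ EProper E (ShortComplex.mk f g w)

/-- `𝒞` is a cogenerator for `𝒯`. -/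
def IsCogenerator (C T : 𝒜 → Prop) : Prop :=
  (∀ ⦃X⦄, C X → T X) ∧
  ∀ X, T X → ∃ (Cb X' : 𝒜) (f : X ⟶ Cb) (g : Cb ⟶ X') (w : f ≫ g = 0),
    C Cb ∧ T X' ∧ (ShortComplex.mk f g w).ShortExact

/-- `𝒯` is closed under `ℰ`-proper extensions. -/
def ClosedUnderProperExtensions (E T : 𝒜 → Prop) : Prop :=
  ∀ S : ShortComplex 𝒜, S.ShortExact → EProper E S → T S.X₁ → T S.X₃ → T S.X₂

/-- `𝒯` is closed under kernels of `ℰ`-proper epimorphisms. -/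
def ClosedUnderProperKernels (E T : 𝒜 → Prop) : Prop :=
  ∀ S : ShortComplex 𝒜, S.ShortExact → EProper E S → T S.X₂ → T S.X₃ → T S.X₁

/-- `𝒯` is an `ℰ`-preresolving subcategory with `ℰ`-proper generator `𝒞`. -/
def IsPreresolving (E T C : 𝒜 → Prop) : Prop :=
  IsProperGenerator E C T ∧ ClosedUnderProperExtensions E T


/-- Exactness of a four-term sequence `0 → M → T₁ → T₀ → A → 0`. -/
def FourTermExact {M T1 T0 A : 𝒜} (f : M ⟶ T1) (g : T1 ⟶ T0) (h : T0 ⟶ A) : Prop :=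
  Mono f ∧ Epi h ∧ ∃ (w₁ : f ≫ g = 0) (w₂ : g ≫ h = 0),
    (ShortComplex.mk f g w₁).Exact ∧ (ShortComplex.mk g h w₂).Exact

/-- `Hom(W,-)`-exactness of the four-term exact sequence `0 → M → T₁ → T₀ → A → 0` :
the induced sequence `0 → Hom(W,M) → Hom(W,T₁) → Hom(W,T₀) → Hom(W,A) → 0` is exact. -/
def CovHomExact4 (W : 𝒜) {M T1 T0 A : 𝒜} (f : M ⟶ T1) (g : T1 ⟶ T0) (h : T0 ⟶ A) : Prop :=
  (∀ a b : W ⟶ M, a ≫ f = b ≫ f → a = b) ∧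
  (∀ b : W ⟶ T1, b ≫ g = 0 → ∃ a : W ⟶ M, a ≫ f = b) ∧
  (∀ c : W ⟶ T0, c ≫ h = 0 → ∃ b : W ⟶ T1, b ≫ g = c) ∧
  (∀ d : W ⟶ A, ∃ c : W ⟶ T0, c ≫ h = d)

/-- There is an exact sequence `0 → M → K⁰ → C¹ → ⋯ → Cⁿ → 0` with `K⁰` in `T`
and all `C^i` in `C`. -/
def MixedCores (T C : 𝒜 → Prop) : ℕ → 𝒜 → Prop
  | 0 => fun M => ∃ K, T K ∧ Nonempty (M ≅ K)
  | n + 1 => fun M => ∃ (K H : 𝒜) (f : M ⟶ K) (g : K ⟶ H) (w : f ≫ g = 0),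
      T K ∧ (ShortComplex.mk f g w).ShortExact ∧ ∃ K', C K' ∧ Cores C n H K'

/-- The Gorenstein subcategory `𝒢(𝒞)` : objects `A` admitting a doubly infinite
exact sequence `⋯ → X_{-1} → X_0 → X_1 → ⋯` with all terms in `𝒞`, which is both
`Hom(𝒞,-)`-exact and `Hom(-,𝒞)`-exact, such that `A ≅ Im(X_0 → X_1)`. -/
def IsGorenstein (P : 𝒜 → Prop) (A : 𝒜) : Prop :=
  ∃ (X : ℤ → 𝒜) (d : ∀ i : ℤ, X i ⟶ X (i + 1)) (w : ∀ i, d i ≫ d (i + 1) = 0),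
    (∀ i, P (X i)) ∧
    (∀ i, (ShortComplex.mk (d i) (d (i + 1)) (w i)).Exact) ∧
    (∀ C, P C → ∀ (i : ℤ) (f : C ⟶ X (i + 1)), f ≫ d (i + 1) = 0 →
      ∃ g : C ⟶ X i, g ≫ d i = f) ∧
    (∀ C, P C → ∀ (i : ℤ) (f : X (i + 1) ⟶ C), d i ≫ f = 0 →
      ∃ g : X (i + 1 + 1) ⟶ C, d (i + 1) ≫ g = f) ∧
    Nonempty (A ≅ Limits.image (d 0))

end RelHomDim

namespace RelHomDim

variable {𝒜 : Type u} [Category.{v} 𝒜] [Abelian 𝒜]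

lemma subsingleton_ext_of_forall_eq_zero [HasExt.{w} 𝒜] {X Y : 𝒜} {n : ℕ}
    (h : ∀ x : Ext X Y n, x = 0) : Subsingleton (Ext X Y n) :=
  ⟨fun a b => by rw [h a, h b]⟩

lemma exists_lift_of_subsingleton_ext [HasExt.{w} 𝒜] {S : ShortComplex 𝒜} (hS : S.ShortExact)
    {W : 𝒜} (hW : Subsingleton (Ext W S.X₁ 1)) (c : W ⟶ S.X₃) :
    ∃ b : W ⟶ S.X₂, b ≫ S.g = c := by
  obtain ⟨x, hx⟩ := Ext.covariant_sequence_exact₃ W hS (Ext.mk₀ c) (zero_add 1)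
    (Subsingleton.elim _ _)
  obtain ⟨b, rfl⟩ := Ext.addEquiv₀.symm.surjective x
  exact ⟨b, Ext.addEquiv₀.symm.injective (by simpa using hx)⟩

lemma exists_extend_of_subsingleton_ext [HasExt.{w} 𝒜] {S : ShortComplex 𝒜} (hS : S.ShortExact)
    {W : 𝒜} (hW : Subsingleton (Ext S.X₃ W 1)) (c : S.X₁ ⟶ W) :
    ∃ b : S.X₂ ⟶ W, S.f ≫ b = c := by
  obtain ⟨x, hx⟩ := Ext.contravariant_sequence_exact₁ hS W (Ext.mk₀ c) (add_zero 1)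
    (Subsingleton.elim _ _)
  obtain ⟨b, rfl⟩ := Ext.addEquiv₀.symm.surjective x
  exact ⟨b, Ext.addEquiv₀.symm.injective (by simpa using hx)⟩

lemma subsingleton_ext_one_of_lift [HasExt.{w} 𝒜] {S : ShortComplex 𝒜} (hS : S.ShortExact)
    {W : 𝒜} (hW : Subsingleton (Ext W S.X₂ 1))
    (h : ∀ c : W ⟶ S.X₃, ∃ b : W ⟶ S.X₂, b ≫ S.g = c) : Subsingleton (Ext W S.X₁ 1) := by
  refine subsingleton_ext_of_forall_eq_zero fun x => ?_
  obtain ⟨y, rfl⟩ := Ext.covariant_sequence_exact₁ W hS x (Subsingleton.elim _ _) (zero_add 1)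
  obtain ⟨c, rfl⟩ := Ext.addEquiv₀.symm.surjective y
  obtain ⟨b, rfl⟩ := h c
  simp [← Ext.mk₀_comp_mk₀]

lemma subsingleton_ext_one_of_extend [HasExt.{w} 𝒜] {S : ShortComplex 𝒜} (hS : S.ShortExact)
    {W : 𝒜} (hW : Subsingleton (Ext S.X₂ W 1))
    (h : ∀ c : S.X₁ ⟶ W, ∃ b : S.X₂ ⟶ W, S.f ≫ b = c) : Subsingleton (Ext S.X₃ W 1) := by
  refine subsingleton_ext_of_forall_eq_zero fun x => ?_
  obtain ⟨y, rfl⟩ := Ext.contravariant_sequence_exact₃ hS W x (Subsingleton.elim _ _) (add_zero 1)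
  obtain ⟨c, rfl⟩ := Ext.addEquiv₀.symm.surjective y
  obtain ⟨b, rfl⟩ := h c
  simp [← Ext.mk₀_comp_mk₀]

lemma subsingleton_ext_to_middle [HasExt.{w} 𝒜] {S : ShortComplex 𝒜} (hS : S.ShortExact)
    {W : 𝒜} {n : ℕ} (h₁ : Subsingleton (Ext W S.X₁ n)) (h₃ : Subsingleton (Ext W S.X₃ n)) :
    Subsingleton (Ext W S.X₂ n) := by
  refine subsingleton_ext_of_forall_eq_zero fun x => ?_
  obtain ⟨y, rfl⟩ := Ext.covariant_sequence_exact₂ W hS x (Subsingleton.elim _ _)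
  rw [Subsingleton.elim y 0, Ext.zero_comp]

lemma subsingleton_ext_from_middle [HasExt.{w} 𝒜] {S : ShortComplex 𝒜} (hS : S.ShortExact)
    {W : 𝒜} {n : ℕ} (h₁ : Subsingleton (Ext S.X₁ W n)) (h₃ : Subsingleton (Ext S.X₃ W n)) :
    Subsingleton (Ext S.X₂ W n) := by
  refine subsingleton_ext_of_forall_eq_zero fun x => ?_
  obtain ⟨y, rfl⟩ := Ext.contravariant_sequence_exact₂ hS W x (Subsingleton.elim _ _)
  rw [Subsingleton.elim y 0, Ext.comp_zero]

lemma subsingleton_ext_from_right [HasExt.{w} 𝒜] {S : ShortComplex 𝒜} (hS : S.ShortExact)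
    {W : 𝒜} {n : ℕ} (h₁ : Subsingleton (Ext S.X₁ W n))
    (h₂ : Subsingleton (Ext S.X₂ W (n + 1))) : Subsingleton (Ext S.X₃ W (n + 1)) := by
  refine subsingleton_ext_of_forall_eq_zero fun x => ?_
  obtain ⟨y, rfl⟩ := Ext.contravariant_sequence_exact₃ hS W x (Subsingleton.elim _ _)
    (add_comm 1 n)
  rw [Subsingleton.elim y 0, Ext.comp_zero]

lemma subsingleton_ext_from_left [HasExt.{w} 𝒜] {S : ShortComplex 𝒜} (hS : S.ShortExact)
    {W : 𝒜} {n : ℕ} (h₂ : Subsingleton (Ext S.X₂ W n))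
    (h₃ : Subsingleton (Ext S.X₃ W (n + 1))) : Subsingleton (Ext S.X₁ W n) := by
  refine subsingleton_ext_of_forall_eq_zero fun x => ?_
  obtain ⟨y, rfl⟩ := Ext.contravariant_sequence_exact₁ hS W x (add_comm 1 n)
    (Subsingleton.elim _ _)
  rw [Subsingleton.elim y 0, Ext.comp_zero]

lemma subsingleton_ext_from_retract [HasExt.{w} 𝒜] {A M W : 𝒜} {n : ℕ} (r : Retract A M)
    (h : Subsingleton (Ext M W n)) : Subsingleton (Ext A W n) := by
  refine subsingleton_ext_of_forall_eq_zero fun x => ?_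
  have : (Ext.mk₀ r.i).comp ((Ext.mk₀ r.r).comp x (zero_add n)) (zero_add n) = x := by
    rw [Ext.mk₀_comp_mk₀_assoc, r.retract, Ext.mk₀_id_comp]
  rw [← this, Subsingleton.elim ((Ext.mk₀ r.r).comp x (zero_add n)) 0, Ext.comp_zero]

lemma subsingleton_ext_to_retract [HasExt.{w} 𝒜] {A M W : 𝒜} {n : ℕ} (r : Retract A M)
    (h : Subsingleton (Ext W M n)) : Subsingleton (Ext W A n) := by
  refine subsingleton_ext_of_forall_eq_zero fun x => ?_
  have : (x.comp (Ext.mk₀ r.i) (add_zero n)).comp (Ext.mk₀ r.r) (add_zero n) = x := by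
    rw [Ext.comp_assoc_of_third_deg_zero, Ext.mk₀_comp_mk₀, r.retract, Ext.comp_mk₀_id]
  rw [← this, Subsingleton.elim (x.comp (Ext.mk₀ r.i) (add_zero n)) 0, Ext.zero_comp]

/-- A class of objects that is orthogonal to `P` in degree one on both sides, and each member of
which is a kernel and a cokernel, with complement in the class, involving an object of `P`. -/
structure IsBiresolved [HasExt.{w} 𝒜] (P Q : 𝒜 → Prop) : Prop where
  ext_to : ∀ ⦃A C⦄, Q A → P C → Subsingleton (Ext A C 1)
  ext_from : ∀ ⦃A C⦄, Q A → P C → Subsingleton (Ext C A 1)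
  coresolve : ∀ ⦃A⦄, Q A → ∃ (X B : 𝒜) (f : A ⟶ X) (g : X ⟶ B) (w : f ≫ g = 0),
    P X ∧ Q B ∧ (ShortComplex.mk f g w).ShortExact
  resolve : ∀ ⦃A⦄, Q A → ∃ (B X : 𝒜) (f : B ⟶ X) (g : X ⟶ A) (w : f ≫ g = 0),
    P X ∧ Q B ∧ (ShortComplex.mk f g w).ShortExact

lemma exists_int_sequence {α : Type*} {r : α → α → Prop} (hr : ∀ a, ∃ b, r a b)
    (hl : ∀ b, ∃ a, r a b) (a : α) : ∃ Z : ℤ → α, Z 0 = a ∧ ∀ i, r (Z i) (Z (i + 1)) := by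
  choose R hR using hr
  choose L hL using hl
  refine ⟨fun | .ofNat n => R^[n] a | .negSucc n => L^[n + 1] a, rfl, ?_⟩
  rintro (n | n)
  · change r (R^[n] a) (R^[n + 1] a)
    rw [Function.iterate_succ_apply']
    exact hR _
  · cases n with
    | zero => exact hL _
    | succ n =>
      change r (L^[n + 1 + 1] a) (L^[n + 1] a)
      rw [Function.iterate_succ_apply' L (n + 1)]
      exact hL _

theorem IsBiresolved.isGorenstein [HasExt.{w} 𝒜] {P Q : 𝒜 → Prop} (h : IsBiresolved P Q)
    {A : 𝒜} (hA : Q A) : IsGorenstein P A := by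
  obtain ⟨Z', hZ'0, hZ'⟩ := exists_int_sequence (α := {B : 𝒜 // Q B})
    (r := fun B B' => ∃ (X : 𝒜) (f : B.1 ⟶ X) (g : X ⟶ B'.1) (w : f ≫ g = 0),
      P X ∧ (ShortComplex.mk f g w).ShortExact)
    (fun B => by
      obtain ⟨X, B', f, g, w, hX, hB', hS⟩ := h.coresolve B.2
      exact ⟨⟨B', hB'⟩, X, f, g, w, hX, hS⟩)
    (fun B => by
      obtain ⟨B', X, f, g, w, hX, hB', hS⟩ := h.resolve B.2
      exact ⟨⟨B', hB'⟩, X, f, g, w, hX, hS⟩) ⟨A, hA⟩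
  obtain ⟨Z, hQ, hZ1, hZ⟩ : ∃ Z : ℤ → 𝒜, (∀ i, Q (Z i)) ∧ Z (0 + 1) = A ∧
      ∀ i, ∃ (X : 𝒜) (f : Z i ⟶ X) (g : X ⟶ Z (i + 1)) (w : f ≫ g = 0),
        P X ∧ (ShortComplex.mk f g w).ShortExact := by
    refine ⟨fun i => (Z' (i - 1)).1, fun i => (Z' _).2, by simp [hZ'0], fun i => ?_⟩
    have := hZ' (i - 1)
    rwa [show i - 1 + 1 = i + 1 - 1 by ring] at this
  choose X f g w hX hS using hZ
  have hf : ∀ i, Mono (f i) := fun i => (hS i).mono_f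
  have hg : ∀ i, Epi (g i) := fun i => (hS i).epi_g
  have w' : ∀ i, (g i ≫ f (i + 1)) ≫ (g (i + 1) ≫ f (i + 1 + 1)) = 0 := fun i => by
    simp [reassoc_of% (w (i + 1))]
  refine ⟨X, fun i => g i ≫ f (i + 1), w', hX, fun i => ?_, fun C hC i c hc => ?_,
    fun C hC i c hc => ?_, ⟨?_⟩⟩
  · let φ : ShortComplex.mk _ _ (w' i) ⟶ ShortComplex.mk (f (i + 1)) (g (i + 1) ≫ f (i + 1 + 1))
        (by simp [reassoc_of% (w (i + 1))]) :=
      { τ₁ := g i, τ₂ := 𝟙 _, τ₃ := 𝟙 _ }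
    let ψ : ShortComplex.mk _ _ (w (i + 1)) ⟶
        ShortComplex.mk (f (i + 1)) (g (i + 1) ≫ f (i + 1 + 1))
          (by simp [reassoc_of% (w (i + 1))]) :=
      { τ₁ := 𝟙 _, τ₂ := 𝟙 _, τ₃ := f (i + 1 + 1) }
    have : Epi φ.τ₁ := hg i
    have : Mono ψ.τ₃ := hf _
    have : IsIso φ.τ₂ := inferInstanceAs (IsIso (𝟙 _))
    have : Mono φ.τ₃ := inferInstanceAs (Mono (𝟙 _))
    have : IsIso ψ.τ₂ := inferInstanceAs (IsIso (𝟙 _))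
    have : Epi ψ.τ₁ := inferInstanceAs (Epi (𝟙 _))
    rw [ShortComplex.exact_iff_of_epi_of_isIso_of_mono φ,
      ← ShortComplex.exact_iff_of_epi_of_isIso_of_mono ψ]
    exact (hS (i + 1)).exact
  · have hc' : c ≫ g (i + 1) = 0 := by
      rw [← cancel_mono (f (i + 1 + 1)), zero_comp, Category.assoc, hc]
    obtain ⟨b, hb⟩ := exists_lift_of_subsingleton_ext (hS i) (h.ext_from (hQ i) hC)
      ((hS (i + 1)).exact.lift c hc')
    exact ⟨b, by
      have := (hS (i + 1)).exact.lift_f c hc'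
      dsimp at hb this
      rw [reassoc_of% hb, this]⟩
  · have hc' : f (i + 1) ≫ c = 0 := by
      rw [← cancel_epi (g i), comp_zero, ← Category.assoc, hc]
    obtain ⟨b, hb⟩ := exists_extend_of_subsingleton_ext (hS (i + 1 + 1))
      (h.ext_to (hQ _) hC) ((hS (i + 1)).exact.desc c hc')
    exact ⟨b, by
      have := (hS (i + 1)).exact.g_desc c hc'
      dsimp at hb this
      rw [Category.assoc, hb, this]⟩
  · have : StrongEpi (g 0) := strongEpi_of_epi _
    exact eqToIso hZ1.symm ≪≫ image.isoStrongEpiMono (g 0) (f (0 + 1)) rfl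

lemma shortExact_factorThruImage {X Y Z : 𝒜} {f : X ⟶ Y} {g : Y ⟶ Z} {w : f ≫ g = 0}
    (h : (ShortComplex.mk f g w).Exact) :
    ∃ w' : Limits.image.ι f ≫ factorThruImage g = 0,
      (ShortComplex.mk (Limits.image.ι f) (factorThruImage g) w').ShortExact := by
  have w' : Limits.image.ι f ≫ factorThruImage g = 0 := by
    rw [← cancel_mono (Limits.image.ι g), ← cancel_epi (factorThruImage f)]
    simpa using w
  refine ⟨w', .mk' ?_ inferInstance inferInstance⟩
  rw [ShortComplex.exact_iff_exact_up_to_refinements] at h ⊢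
  intro T x hx
  obtain ⟨T', π, hπ, y, hy⟩ := h x (by
    simpa using hx =≫ Limits.image.ι g)
  exact ⟨T', π, hπ, y ≫ factorThruImage f, by simpa using hy⟩

theorem isBiresolved_isGorenstein [HasExt.{w} 𝒜] {P : 𝒜 → Prop}
    (horth : ∀ C₁ C₂ : 𝒜, P C₁ → P C₂ → ∀ i : ℕ, 1 ≤ i → Subsingleton (Ext C₁ C₂ i)) :
    IsBiresolved P (IsGorenstein P) := by
  have key : ∀ {X : ℤ → 𝒜} {d : ∀ i : ℤ, X i ⟶ X (i + 1)} {w : ∀ i, d i ≫ d (i + 1) = 0},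
      (∀ i, P (X i)) → (∀ i, (ShortComplex.mk (d i) (d (i + 1)) (w i)).Exact) →
      (∀ C, P C → ∀ (i : ℤ) (f : C ⟶ X (i + 1)), f ≫ d (i + 1) = 0 →
        ∃ g : C ⟶ X i, g ≫ d i = f) →
      (∀ C, P C → ∀ (i : ℤ) (f : X (i + 1) ⟶ C), d i ≫ f = 0 →
        ∃ g : X (i + 1 + 1) ⟶ C, d (i + 1) ≫ g = f) →
      IsBiresolved P (fun B => ∃ i, Nonempty (B ≅ image (d i))) := by
    intro X d w hX hd hfrom hto
    refine ⟨?_, ?_, ?_, ?_⟩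
    · rintro B C ⟨i, ⟨e⟩⟩ hC
      obtain ⟨j, rfl⟩ : ∃ j, i = j + 1 + 1 := ⟨i - 2, by ring⟩
      obtain ⟨w', hS⟩ := shortExact_factorThruImage (hd (j + 1))
      refine subsingleton_ext_from_retract e.retract
        (subsingleton_ext_one_of_extend hS (horth _ _ (hX _) hC 1 le_rfl) fun c => ?_)
      obtain ⟨b, hb⟩ := hto C hC j (factorThruImage (d (j + 1)) ≫ c) (by
        have : d j ≫ factorThruImage (d (j + 1)) = 0 := by
          rw [← cancel_mono (Limits.image.ι (d (j + 1)))]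
          simpa using w j
        rw [reassoc_of% this, zero_comp])
      exact ⟨b, by
        dsimp
        rw [← cancel_epi (factorThruImage (d (j + 1))), image.fac_assoc, hb]⟩
    · rintro B C ⟨i, ⟨e⟩⟩ hC
      obtain ⟨w', hS⟩ := shortExact_factorThruImage (hd i)
      refine subsingleton_ext_to_retract e.retract
        (subsingleton_ext_one_of_lift hS (horth _ _ hC (hX _) 1 le_rfl) fun c => ?_)
      obtain ⟨b, hb⟩ := hfrom C hC (i + 1) (c ≫ Limits.image.ι (d (i + 1))) (by
        have : Limits.image.ι (d (i + 1)) ≫ d (i + 1 + 1) = 0 := by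
          rw [← cancel_epi (factorThruImage (d (i + 1)))]
          simpa using w (i + 1)
        rw [Category.assoc, this, comp_zero])
      exact ⟨b, by
        dsimp
        rw [← cancel_mono (Limits.image.ι (d (i + 1))), Category.assoc, Limits.image.fac, hb]⟩
    · rintro B ⟨i, ⟨e⟩⟩
      obtain ⟨w', hS⟩ := shortExact_factorThruImage (hd i)
      refine ⟨X (i + 1), image (d (i + 1)), e.hom ≫ Limits.image.ι (d i), factorThruImage (d (i + 1)),
        by simp [w'], hX _, ⟨_, ⟨Iso.refl _⟩⟩, ?_⟩
      exact ShortComplex.shortExact_of_iso (S₁ := ShortComplex.mk _ _ w')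
        (ShortComplex.isoMk e.symm (Iso.refl _) (Iso.refl _)) hS
    · rintro B ⟨i, ⟨e⟩⟩
      obtain ⟨j, rfl⟩ : ∃ j, i = j + 1 := ⟨i - 1, by ring⟩
      obtain ⟨w', hS⟩ := shortExact_factorThruImage (hd j)
      refine ⟨image (d j), X (j + 1), Limits.image.ι (d j), factorThruImage (d (j + 1)) ≫ e.inv,
        by simp [reassoc_of% w'], hX _, ⟨_, ⟨Iso.refl _⟩⟩, ?_⟩
      exact ShortComplex.shortExact_of_iso (S₁ := ShortComplex.mk _ _ w')
        (ShortComplex.isoMk (Iso.refl _) (Iso.refl _) e.symm) hS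
  refine ⟨?_, ?_, ?_, ?_⟩
  · rintro A C ⟨X, d, w, hX, hd, hfrom, hto, he⟩ hC
    exact (key hX hd hfrom hto).ext_to ⟨0, he⟩ hC
  · rintro A C ⟨X, d, w, hX, hd, hfrom, hto, he⟩ hC
    exact (key hX hd hfrom hto).ext_from ⟨0, he⟩ hC
  · rintro A ⟨X, d, w, hX, hd, hfrom, hto, he⟩
    have h := key hX hd hfrom hto
    obtain ⟨Y, B, f, g, w, hY, hB, hS⟩ := h.coresolve ⟨0, he⟩
    exact ⟨Y, B, f, g, w, hY, h.isGorenstein hB, hS⟩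
  · rintro A ⟨X, d, w, hX, hd, hfrom, hto, he⟩
    have h := key hX hd hfrom hto
    obtain ⟨B, Y, f, g, w, hY, hB, hS⟩ := h.resolve ⟨0, he⟩
    exact ⟨B, Y, f, g, w, hY, h.isGorenstein hB, hS⟩

theorem IsBiresolved.memLeftPerp [HasExt.{w} 𝒜] {P Q : 𝒜 → Prop} (h : IsBiresolved P Q)
    (horth : ∀ C₁ C₂ : 𝒜, P C₁ → P C₂ → ∀ i : ℕ, 1 ≤ i → Subsingleton (Ext C₁ C₂ i))
    {A : 𝒜} (hA : Q A) : MemLeftPerp P A := by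
  intro C hC i hi
  induction i, hi using Nat.le_induction generalizing A with
  | base => exact h.ext_to hA hC
  | succ n hn ih =>
    obtain ⟨B, X, f, g, w, hX, hB, hS⟩ := h.resolve hA
    exact subsingleton_ext_from_right hS (ih hB) (horth _ _ hX hC _ (by omega))

theorem isGorenstein_of_mem [HasExt.{w} 𝒜] {P : 𝒜 → Prop} (hP : IsAdditiveClass P)
    (horth : ∀ C₁ C₂ : 𝒜, P C₁ → P C₂ → ∀ i : ℕ, 1 ≤ i → Subsingleton (Ext C₁ C₂ i))
    {A : 𝒜} (hA : P A) : IsGorenstein P A := by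
  have h : IsBiresolved P P := by
    refine ⟨fun A C hA hC => horth _ _ hA hC 1 le_rfl, fun A C hA hC => horth _ _ hC hA 1 le_rfl,
      fun A hA => ⟨A, 0, 𝟙 A, 0, by simp, hA, hP.1, ?_⟩,
      fun A hA => ⟨0, A, 0, 𝟙 A, by simp, hA, hP.1, ?_⟩⟩
    · exact ShortComplex.Splitting.shortExact { r := 𝟙 A, s := 0 }
    · exact ShortComplex.Splitting.shortExact { r := 0, s := 𝟙 A }
  exact h.isGorenstein hA

lemma exists_shortExact_cokernel_of_extension {G₁ E G₂ X₁ X₂ B₁ B₂ : 𝒜}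
    {i : G₁ ⟶ E} {p : E ⟶ G₂} {w : i ≫ p = 0} (hS : (ShortComplex.mk i p w).ShortExact)
    {a₁ : G₁ ⟶ X₁} {b₁ : X₁ ⟶ B₁} {w₁ : a₁ ≫ b₁ = 0}
    (h₁ : (ShortComplex.mk a₁ b₁ w₁).ShortExact)
    {a₂ : G₂ ⟶ X₂} {b₂ : X₂ ⟶ B₂} {w₂ : a₂ ≫ b₂ = 0}
    (h₂ : (ShortComplex.mk a₂ b₂ w₂).ShortExact)
    {ψ : E ⟶ X₁} (hψ : i ≫ ψ = a₁) :
    ∃ (Y : 𝒜) (j : E ⟶ X₁ ⊞ X₂) (q : X₁ ⊞ X₂ ⟶ Y) (wj : j ≫ q = 0)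
      (α : B₁ ⟶ Y) (β : Y ⟶ B₂) (wα : α ≫ β = 0),
      (ShortComplex.mk j q wj).ShortExact ∧ (ShortComplex.mk α β wα).ShortExact := by
  have := h₁.mono_f; have := h₁.epi_g; have := h₂.mono_f; have := h₂.epi_g
  have := hS.mono_f; have := hS.epi_g
  dsimp at *
  let j : E ⟶ X₁ ⊞ X₂ := biprod.lift ψ (p ≫ a₂)
  have hj : Mono j := by
    refine Preadditive.mono_of_cancel_zero _ fun {T} e he => ?_
    have e1 : e ≫ ψ = 0 := by simpa [j] using he =≫ biprod.fst
    have e2 : e ≫ p = 0 := by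
      rw [← cancel_mono a₂]
      simpa [j] using he =≫ biprod.snd
    have e3 : hS.exact.lift e e2 ≫ i = e := hS.exact.lift_f e e2
    have e4 : hS.exact.lift e e2 = 0 := by
      rw [← cancel_mono a₁, ← hψ, reassoc_of% e3, e1, zero_comp]
    rw [← e3, e4, zero_comp]
  have hinl : a₁ ≫ biprod.inl = i ≫ j := by
    ext <;> simp [j, hψ, reassoc_of% w]
  have hjS : (ShortComplex.mk j (cokernel.π j) (cokernel.condition j)).ShortExact :=
    .mk' (ShortComplex.exact_cokernel j) hj inferInstance
  have hα : a₁ ≫ biprod.inl ≫ cokernel.π j = 0 := by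
    rw [reassoc_of% hinl, cokernel.condition, comp_zero]
  have hβ : j ≫ biprod.snd ≫ b₂ = 0 := by simp [j, w₂]
  let α : B₁ ⟶ cokernel j := h₁.exact.desc _ hα
  have hα' : b₁ ≫ α = biprod.inl ≫ cokernel.π j := h₁.exact.g_desc _ hα
  let β : cokernel j ⟶ B₂ := cokernel.desc j _ hβ
  have hβ' : cokernel.π j ≫ β = biprod.snd ≫ b₂ := cokernel.π_desc j _ hβ
  have wα : α ≫ β = 0 := by
    rw [← cancel_epi b₁, reassoc_of% hα', hβ']
    simp
  refine ⟨_, j, cokernel.π j, cokernel.condition j, α, β, wα, hjS, .mk' ?_ ?_ ?_⟩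
  · rw [ShortComplex.exact_iff_exact_up_to_refinements]
    intro T y hy
    dsimp at y hy ⊢
    obtain ⟨T₁, π₁, _, u, hu⟩ := surjective_up_to_refinements_of_epi (cokernel.π j) y
    have hu2 : (u ≫ biprod.snd) ≫ b₂ = 0 := by
      rw [Category.assoc, ← hβ', ← reassoc_of% hu, hy, comp_zero]
    obtain ⟨e, he⟩ : ∃ e, e ≫ a₂ = u ≫ biprod.snd := ⟨_, h₂.exact.lift_f _ hu2⟩
    obtain ⟨T₂, π₂, _, v, hv⟩ := surjective_up_to_refinements_of_epi p e
    refine ⟨T₂, π₂ ≫ π₁, inferInstance, (π₂ ≫ u ≫ biprod.fst - v ≫ ψ) ≫ b₁, ?_⟩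
    have : (π₂ ≫ u ≫ biprod.fst - v ≫ ψ) ≫ biprod.inl = π₂ ≫ u - v ≫ j := by
      ext
      · simp [j]
      · simp [j, ← he, reassoc_of% hv]
    rw [Category.assoc _ b₁, hα', reassoc_of% this, Category.assoc, hu]
    simp
  · refine Preadditive.mono_of_cancel_zero _ fun {T} x hx => ?_
    dsimp at x hx
    obtain ⟨T₁, π₁, _, u, hu⟩ := surjective_up_to_refinements_of_epi b₁ x
    have h0 : (u ≫ biprod.inl) ≫ cokernel.π j = 0 := by
      rw [Category.assoc, ← hα', ← reassoc_of% hu, hx, comp_zero]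
    obtain ⟨e, he⟩ : ∃ e, e ≫ j = u ≫ biprod.inl := ⟨_, hjS.exact.lift_f _ h0⟩
    have e1 : e ≫ ψ = u := by simpa [j] using he =≫ biprod.fst
    have e2 : e ≫ p = 0 := by
      rw [← cancel_mono a₂]
      simpa [j] using he =≫ biprod.snd
    obtain ⟨g, hg⟩ : ∃ g, g ≫ i = e := ⟨_, hS.exact.lift_f e e2⟩
    rw [← cancel_epi π₁, hu, ← e1, ← hg, Category.assoc, Category.assoc, reassoc_of% hψ, w₁]
    simp
  · have : Epi (cokernel.π j ≫ β) := by
      rw [hβ']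
      infer_instance
    exact epi_of_epi (cokernel.π j) β

lemma exists_shortExact_kernel_of_extension {G₁ E G₂ X₁ X₂ B₁ B₂ : 𝒜}
    {i : G₁ ⟶ E} {p : E ⟶ G₂} {w : i ≫ p = 0} (hS : (ShortComplex.mk i p w).ShortExact)
    {b₁ : B₁ ⟶ X₁} {a₁ : X₁ ⟶ G₁} {w₁ : b₁ ≫ a₁ = 0}
    (h₁ : (ShortComplex.mk b₁ a₁ w₁).ShortExact)
    {b₂ : B₂ ⟶ X₂} {a₂ : X₂ ⟶ G₂} {w₂ : b₂ ≫ a₂ = 0}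
    (h₂ : (ShortComplex.mk b₂ a₂ w₂).ShortExact)
    {χ : X₂ ⟶ E} (hχ : χ ≫ p = a₂) :
    ∃ (Y : 𝒜) (q : Y ⟶ X₁ ⊞ X₂) (j : X₁ ⊞ X₂ ⟶ E) (wj : q ≫ j = 0)
      (α : B₁ ⟶ Y) (β : Y ⟶ B₂) (wα : α ≫ β = 0),
      (ShortComplex.mk q j wj).ShortExact ∧ (ShortComplex.mk α β wα).ShortExact := by
  have := h₁.mono_f; have := h₁.epi_g; have := h₂.mono_f; have := h₂.epi_g
  have := hS.mono_f; have := hS.epi_g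
  dsimp at *
  let j : X₁ ⊞ X₂ ⟶ E := biprod.desc (a₁ ≫ i) χ
  have hj : Epi j := by
    refine Preadditive.epi_of_cancel_zero _ fun {T} e he => ?_
    have e1 : χ ≫ e = 0 := by simpa [j] using biprod.inr ≫= he
    have e2 : i ≫ e = 0 := by
      rw [← cancel_epi a₁]
      simpa [j] using biprod.inl ≫= he
    have e3 : p ≫ hS.exact.desc e e2 = e := hS.exact.g_desc e e2
    have e4 : hS.exact.desc e e2 = 0 := by
      rw [← cancel_epi a₂, ← hχ, Category.assoc, e3, e1, comp_zero]
    rw [← e3, e4, comp_zero]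
  have hsnd : j ≫ p = biprod.snd ≫ a₂ := by
    ext <;> simp [j, hχ, w]
  have hjS : (ShortComplex.mk (kernel.ι j) j (kernel.condition j)).ShortExact :=
    .mk' (ShortComplex.exact_kernel j) inferInstance hj
  have hα : (b₁ ≫ biprod.inl) ≫ j = 0 := by simp [j, reassoc_of% w₁]
  have hβ : (kernel.ι j ≫ biprod.snd) ≫ a₂ = 0 := by
    rw [Category.assoc, ← hsnd, kernel.condition_assoc, zero_comp]
  let α : B₁ ⟶ kernel j := kernel.lift j _ hα
  have hα' : α ≫ kernel.ι j = b₁ ≫ biprod.inl := kernel.lift_ι j _ hα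
  let β : kernel j ⟶ B₂ := h₂.exact.lift _ hβ
  have hβ' : β ≫ b₂ = kernel.ι j ≫ biprod.snd := h₂.exact.lift_f _ hβ
  have wα : α ≫ β = 0 := by
    rw [← cancel_mono b₂, Category.assoc, hβ', reassoc_of% hα']
    simp
  refine ⟨_, kernel.ι j, j, kernel.condition j, α, β, wα, hjS, .mk' ?_ ?_ ?_⟩
  · rw [ShortComplex.exact_iff_exact_up_to_refinements]
    intro T y hy
    dsimp at y hy ⊢
    have hy2 : (y ≫ kernel.ι j) ≫ biprod.snd = 0 := by
      rw [Category.assoc, ← hβ', reassoc_of% hy, zero_comp]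
    have hy1 : ((y ≫ kernel.ι j) ≫ biprod.fst) ≫ biprod.inl = y ≫ kernel.ι j := by
      ext <;> simp [← hy2]
    have h0 : ((y ≫ kernel.ι j) ≫ biprod.fst) ≫ a₁ = 0 := by
      rw [← cancel_mono i, Category.assoc,
        show a₁ ≫ i = biprod.inl ≫ j by simp [j], ← Category.assoc _ biprod.inl, hy1, Category.assoc,
        kernel.condition]
      simp
    obtain ⟨e, he⟩ : ∃ e, e ≫ b₁ = (y ≫ kernel.ι j) ≫ biprod.fst := ⟨_, h₁.exact.lift_f _ h0⟩
    refine ⟨T, 𝟙 T, inferInstance, e, ?_⟩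
    rw [← cancel_mono (kernel.ι j), Category.assoc, Category.assoc, hα', reassoc_of% he,
      Category.id_comp]
    simpa using hy1.symm
  · have : Mono (α ≫ kernel.ι j) := by
      rw [hα']
      infer_instance
    exact mono_of_mono α (kernel.ι j)
  · rw [epi_iff_surjective_up_to_refinements]
    intro T k
    dsimp at k ⊢
    have h0 : (k ≫ b₂ ≫ χ) ≫ p = 0 := by simp [hχ, w₂]
    obtain ⟨g, hg⟩ : ∃ g, g ≫ i = k ≫ b₂ ≫ χ := ⟨_, hS.exact.lift_f _ h0⟩
    obtain ⟨T₁, π₁, _, u, hu⟩ := surjective_up_to_refinements_of_epi a₁ g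
    have h1 : biprod.lift (-u) (π₁ ≫ k ≫ b₂) ≫ j = 0 := by
      simp [j, ← hg, reassoc_of% hu]
    refine ⟨T₁, π₁, inferInstance, kernel.lift j _ h1, ?_⟩
    rw [← cancel_mono b₂, Category.assoc, Category.assoc, hβ', kernel.lift_ι_assoc]
    simp

theorem isGorenstein_of_shortExact [HasExt.{w} 𝒜] {P : 𝒜 → Prop} (hP : IsAdditiveClass P)
    (horth : ∀ C₁ C₂ : 𝒜, P C₁ → P C₂ → ∀ i : ℕ, 1 ≤ i → Subsingleton (Ext C₁ C₂ i))
    {G₁ E G₂ : 𝒜} {i : G₁ ⟶ E} {p : E ⟶ G₂} {w : i ≫ p = 0}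
    (hS : (ShortComplex.mk i p w).ShortExact)
    (h₁ : IsGorenstein P G₁) (h₂ : IsGorenstein P G₂) : IsGorenstein P E := by
  have hG := isBiresolved_isGorenstein horth
  have h : IsBiresolved P (fun E => ∃ (G₁ G₂ : 𝒜) (i : G₁ ⟶ E) (p : E ⟶ G₂) (w : i ≫ p = 0),
      IsGorenstein P G₁ ∧ IsGorenstein P G₂ ∧ (ShortComplex.mk i p w).ShortExact) := by
    refine ⟨?_, ?_, ?_, ?_⟩
    · rintro E C ⟨G₁, G₂, i, p, w, h₁, h₂, hS⟩ hC
      exact subsingleton_ext_from_middle hS (hG.ext_to h₁ hC) (hG.ext_to h₂ hC)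
    · rintro E C ⟨G₁, G₂, i, p, w, h₁, h₂, hS⟩ hC
      exact subsingleton_ext_to_middle hS (hG.ext_from h₁ hC) (hG.ext_from h₂ hC)
    · rintro E ⟨G₁, G₂, i, p, w, h₁, h₂, hS⟩
      obtain ⟨X₁, B₁, a₁, b₁, w₁, hX₁, hB₁, hS₁⟩ := hG.coresolve h₁
      obtain ⟨X₂, B₂, a₂, b₂, w₂, hX₂, hB₂, hS₂⟩ := hG.coresolve h₂
      obtain ⟨ψ, hψ⟩ := exists_extend_of_subsingleton_ext hS (hG.ext_to h₂ hX₁) a₁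
      obtain ⟨Y, j, q, wj, α, β, wα, hj, hα⟩ :=
        exists_shortExact_cokernel_of_extension hS hS₁ hS₂ hψ
      exact ⟨_, Y, j, q, wj, hP.2.2 hX₁ hX₂, ⟨B₁, B₂, α, β, wα, hB₁, hB₂, hα⟩, hj⟩
    · rintro E ⟨G₁, G₂, i, p, w, h₁, h₂, hS⟩
      obtain ⟨B₁, X₁, b₁, a₁, w₁, hX₁, hB₁, hS₁⟩ := hG.resolve h₁
      obtain ⟨B₂, X₂, b₂, a₂, w₂, hX₂, hB₂, hS₂⟩ := hG.resolve h₂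
      obtain ⟨χ, hχ⟩ := exists_lift_of_subsingleton_ext hS (hG.ext_from h₁ hX₂) a₂
      obtain ⟨Y, q, j, wj, α, β, wα, hj, hα⟩ :=
        exists_shortExact_kernel_of_extension hS hS₁ hS₂ hχ
      exact ⟨Y, _, q, j, wj, hP.2.2 hX₁ hX₂, ⟨B₁, B₂, α, β, wα, hB₁, hB₂, hα⟩, hj⟩
  exact h.isGorenstein ⟨G₁, G₂, i, p, w, h₁, h₂, hS⟩

theorem isGorenstein_biprod [HasExt.{w} 𝒜] {P : 𝒜 → Prop} (hP : IsAdditiveClass P)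
    (horth : ∀ C₁ C₂ : 𝒜, P C₁ → P C₂ → ∀ i : ℕ, 1 ≤ i → Subsingleton (Ext C₁ C₂ i))
    {G₁ G₂ : 𝒜} (h₁ : IsGorenstein P G₁) (h₂ : IsGorenstein P G₂) :
    IsGorenstein P (G₁ ⊞ G₂) :=
  isGorenstein_of_shortExact hP horth
    (i := biprod.inl) (p := biprod.snd) (w := biprod.inl_snd)
    (ShortComplex.Splitting.shortExact { r := biprod.fst, s := biprod.inr }) h₁ h₂

theorem isGorenstein_of_retract [HasExt.{w} 𝒜] {P : 𝒜 → Prop} (hP : IsAdditiveClass P)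
    (horth : ∀ C₁ C₂ : 𝒜, P C₁ → P C₂ → ∀ i : ℕ, 1 ≤ i → Subsingleton (Ext C₁ C₂ i))
    {A M : 𝒜} (r : Retract A M) (hM : IsGorenstein P M) : IsGorenstein P A := by
  have hG := isBiresolved_isGorenstein horth
  have h : IsBiresolved P (fun A => ∃ M, Nonempty (Retract A M) ∧ IsGorenstein P M) := by
    refine ⟨?_, ?_, ?_, ?_⟩
    · rintro A C ⟨M, ⟨r⟩, hM⟩ hC
      exact subsingleton_ext_from_retract r (hG.ext_to hM hC)
    · rintro A C ⟨M, ⟨r⟩, hM⟩ hC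
      exact subsingleton_ext_to_retract r (hG.ext_from hM hC)
    · rintro A ⟨M, ⟨r⟩, hM⟩
      obtain ⟨X, B, f, g, w, hX, hB, hS⟩ := hG.coresolve hM
      obtain ⟨φ, hφ⟩ := exists_extend_of_subsingleton_ext hS (hG.ext_to hB hX) (r.r ≫ r.i ≫ f)
      have := hS.mono_f; have := hS.epi_g
      dsimp at *
      have hρ : f ≫ φ ≫ cokernel.π (r.i ≫ f) = 0 := by
        rw [reassoc_of% hφ]
        rw [← Category.assoc r.i, cokernel.condition, comp_zero]
      have hg : (r.i ≫ f) ≫ g = 0 := by simp [w]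
      have hφ' : (r.i ≫ f) ≫ (𝟙 X - φ) = 0 := by simp [hφ]
      obtain ⟨ρ, hρ'⟩ : ∃ ρ, g ≫ ρ = φ ≫ cokernel.π (r.i ≫ f) := ⟨_, hS.exact.g_desc _ hρ⟩
      refine ⟨X, cokernel (r.i ≫ f), r.i ≫ f, cokernel.π _, cokernel.condition _, hX,
        ⟨B ⊞ X, ⟨{
          i := biprod.lift (cokernel.desc _ g hg) (cokernel.desc _ (𝟙 X - φ) hφ')
          r := biprod.desc ρ (cokernel.π _)
          retract := by
            rw [← cancel_epi (cokernel.π (r.i ≫ f))]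
            simp [hρ'] }⟩, isGorenstein_biprod hP horth hB (isGorenstein_of_mem hP horth hX)⟩,
        .mk' (ShortComplex.exact_cokernel _) ?_ ?_⟩
      · dsimp; infer_instance
      · dsimp; infer_instance
    · rintro A ⟨M, ⟨r⟩, hM⟩
      obtain ⟨B, X, f, g, w, hX, hB, hS⟩ := hG.resolve hM
      obtain ⟨φ, hφ⟩ := exists_lift_of_subsingleton_ext hS (hG.ext_from hB hX) (g ≫ r.r ≫ r.i)
      have := hS.mono_f; have := hS.epi_g
      dsimp at *
      have hρ : (kernel.ι (g ≫ r.r) ≫ φ) ≫ g = 0 := by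
        rw [Category.assoc, hφ]
        rw [← Category.assoc g, kernel.condition_assoc, zero_comp]
      have hf : f ≫ g ≫ r.r = 0 := by simp [reassoc_of% w]
      have hφ' : (𝟙 X - φ) ≫ g ≫ r.r = 0 := by simp [reassoc_of% hφ]
      obtain ⟨ρ, hρ'⟩ : ∃ ρ, ρ ≫ f = kernel.ι (g ≫ r.r) ≫ φ := ⟨_, hS.exact.lift_f _ hρ⟩
      refine ⟨kernel (g ≫ r.r), X, kernel.ι _, g ≫ r.r, kernel.condition _, hX,
        ⟨B ⊞ X, ⟨{
          i := biprod.lift ρ (kernel.ι _)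
          r := biprod.desc (kernel.lift _ f hf) (kernel.lift _ (𝟙 X - φ) hφ')
          retract := by
            rw [← cancel_mono (kernel.ι (g ≫ r.r))]
            simp [hρ'] }⟩, isGorenstein_biprod hP horth hB (isGorenstein_of_mem hP horth hX)⟩,
        .mk' (ShortComplex.exact_kernel _) ?_ ?_⟩
      · dsimp; infer_instance
      · dsimp; infer_instance
  exact h.isGorenstein ⟨M, ⟨r⟩, hM⟩

lemma exists_shortExact_of_extend {G₁ G₀ A X B : 𝒜} {i : G₁ ⟶ G₀} {p : G₀ ⟶ A} {w : i ≫ p = 0}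
    (hS : (ShortComplex.mk i p w).ShortExact) {f : G₁ ⟶ X} {g : X ⟶ B} {w' : f ≫ g = 0}
    (hS' : (ShortComplex.mk f g w').ShortExact) {φ : G₀ ⟶ X} (hφ : i ≫ φ = f) :
    ∃ (a : G₀ ⟶ X ⊞ A) (b : X ⊞ A ⟶ B) (w'' : a ≫ b = 0),
      (ShortComplex.mk a b w'').ShortExact := by
  have := hS.mono_f; have := hS.epi_g; have := hS'.mono_f; have := hS'.epi_g
  dsimp at *
  have h0 : i ≫ φ ≫ g = 0 := by rw [reassoc_of% hφ, w']
  obtain ⟨c, hc⟩ : ∃ c, p ≫ c = φ ≫ g := ⟨_, hS.exact.g_desc _ h0⟩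
  refine ⟨biprod.lift φ p, biprod.desc g (-c), by simp [hc], .mk' ?_ ?_ ?_⟩
  · rw [ShortComplex.exact_iff_exact_up_to_refinements]
    intro T x hx
    dsimp at x hx ⊢
    have hx' : (x ≫ biprod.fst) ≫ g = (x ≫ biprod.snd) ≫ c := by
      have hx2 : x ≫ (biprod.fst ≫ g + biprod.snd ≫ (-c)) = 0 := by
        rw [← biprod.desc_eq]; exact hx
      rw [← sub_eq_zero]
      simpa [sub_eq_add_neg] using hx2
    obtain ⟨T₁, π₁, _, u, hu⟩ := surjective_up_to_refinements_of_epi p (x ≫ biprod.snd)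
    have h1 : (π₁ ≫ x ≫ biprod.fst - u ≫ φ) ≫ g = 0 := by
      simp only [Category.assoc] at hx' hu
      simp [hx', reassoc_of% hu, hc]
    obtain ⟨e, he⟩ : ∃ e, e ≫ f = π₁ ≫ x ≫ biprod.fst - u ≫ φ := ⟨_, hS'.exact.lift_f _ h1⟩
    refine ⟨T₁, π₁, inferInstance, u + e ≫ i, ?_⟩
    ext
    · simp [hφ, he]
    · simpa [w] using hu
  · refine Preadditive.mono_of_cancel_zero _ fun {T} x hx => ?_
    dsimp at x hx
    have h1 : x ≫ φ = 0 := by simpa using hx =≫ biprod.fst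
    have h2 : x ≫ p = 0 := by simpa using hx =≫ biprod.snd
    obtain ⟨e, he⟩ : ∃ e, e ≫ i = x := ⟨_, hS.exact.lift_f _ h2⟩
    have h3 : e = 0 := by
      rw [← cancel_mono f, ← hφ, reassoc_of% he, h1, zero_comp]
    rw [← he, h3, zero_comp]
  · have : Epi (biprod.inl ≫ biprod.desc g (-c)) := by
      rw [biprod.inl_desc]
      infer_instance
    exact epi_of_epi biprod.inl _

theorem isGorenstein_of_shortExact_of_memLeftPerp [HasExt.{w} 𝒜] {P : 𝒜 → Prop}
    (hP : IsAdditiveClass P)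
    (horth : ∀ C₁ C₂ : 𝒜, P C₁ → P C₂ → ∀ i : ℕ, 1 ≤ i → Subsingleton (Ext C₁ C₂ i))
    {G₁ G₀ A : 𝒜} {i : G₁ ⟶ G₀} {p : G₀ ⟶ A} {w : i ≫ p = 0}
    (hS : (ShortComplex.mk i p w).ShortExact) (h₁ : IsGorenstein P G₁) (h₀ : IsGorenstein P G₀)
    (hA : MemLeftPerp P A) : IsGorenstein P A := by
  obtain ⟨X, B, f, g, w', hX, hB, hS'⟩ := (isBiresolved_isGorenstein horth).coresolve h₁
  obtain ⟨φ, hφ⟩ := exists_extend_of_subsingleton_ext hS (hA X hX 1 le_rfl) f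
  obtain ⟨a, b, w'', hS''⟩ := exists_shortExact_of_extend hS hS' hφ
  exact isGorenstein_of_retract hP horth { i := biprod.inr, r := biprod.snd }
    (isGorenstein_of_shortExact hP horth hS'' h₀ hB)

lemma IsGorenstein.of_iso {P : 𝒜 → Prop} {A B : 𝒜} (e : A ≅ B) (hB : IsGorenstein P B) :
    IsGorenstein P A := by
  obtain ⟨X, d, w, hX, hd, hfrom, hto, ⟨e'⟩⟩ := hB
  exact ⟨X, d, w, hX, hd, hfrom, hto, ⟨e ≪≫ e'⟩⟩

lemma ResW.mono {P Q : 𝒜 → Prop} (h : ∀ X, P X → Q X) {W : ShortComplex 𝒜 → Prop} {n : ℕ}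
    {K A : 𝒜} (hA : ResW P W n K A) : ResW Q W n K A := by
  induction n generalizing A with
  | zero => exact hA
  | succ n ih =>
    obtain ⟨B, X, f, g, w, hX, hS, hW, hB⟩ := hA
    exact ⟨B, X, f, g, w, h _ hX, hS, hW, ih hB⟩

lemma subsingleton_ext_of_res_memLeftPerp [HasExt.{w} 𝒜] {P : 𝒜 → Prop} {n : ℕ} {K A : 𝒜}
    (hK : MemLeftPerp P K) (hA : Res (MemLeftPerp P) n K A) {C : 𝒜} (hC : P C) {i : ℕ}
    (hi : n < i) : Subsingleton (Ext A C i) := by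
  induction n generalizing A i with
  | zero =>
    obtain ⟨e⟩ := hA
    exact subsingleton_ext_from_retract e.symm.retract (hK C hC i hi)
  | succ n ih =>
    obtain ⟨B, X, f, g, w, hX, hS, -, hB⟩ := hA
    obtain ⟨i, rfl⟩ : ∃ j, i = j + 1 := ⟨i - 1, by omega⟩
    exact subsingleton_ext_from_right hS (ih hB (by omega)) (hX C hC _ (by omega))

lemma exists_res_isGorenstein_of_succ [HasExt.{w} 𝒜] {P : 𝒜 → Prop} (hP : IsAdditiveClass P)
    (horth : ∀ C₁ C₂ : 𝒜, P C₁ → P C₂ → ∀ i : ℕ, 1 ≤ i → Subsingleton (Ext C₁ C₂ i))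
    {m : ℕ} {K A : 𝒜} (hK : IsGorenstein P K) (hA : Res (IsGorenstein P) (m + 1) K A)
    (hext : ∀ C, P C → ∀ i, m < i → Subsingleton (Ext A C i)) :
    ∃ K', IsGorenstein P K' ∧ Res (IsGorenstein P) m K' A := by
  induction m generalizing A with
  | zero =>
    obtain ⟨B, X, f, g, w, hX, hS, -, ⟨e⟩⟩ := hA
    exact ⟨A, isGorenstein_of_shortExact_of_memLeftPerp hP horth hS (hK.of_iso e.symm) hX hext,
      ⟨Iso.refl A⟩⟩
  | succ m ih =>
    obtain ⟨B, X, f, g, w, hX, hS, -, hB⟩ := hA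
    have hX' := (isBiresolved_isGorenstein horth).memLeftPerp horth hX
    obtain ⟨K', hK', hR⟩ := ih hB fun C hC i hi =>
      subsingleton_ext_from_left hS (hX' C hC i (by omega)) (hext C hC (i + 1) (by omega))
    exact ⟨K', hK', B, X, f, g, w, hX, hS, trivial, hR⟩

lemma exists_res_isGorenstein_of_le [HasExt.{w} 𝒜] {P : 𝒜 → Prop} (hP : IsAdditiveClass P)
    (horth : ∀ C₁ C₂ : 𝒜, P C₁ → P C₂ → ∀ i : ℕ, 1 ≤ i → Subsingleton (Ext C₁ C₂ i))
    {m n : ℕ} (hmn : m ≤ n) {K A : 𝒜} (hK : IsGorenstein P K)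
    (hA : Res (IsGorenstein P) n K A)
    (hext : ∀ C, P C → ∀ i, m < i → Subsingleton (Ext A C i)) :
    ∃ K', IsGorenstein P K' ∧ Res (IsGorenstein P) m K' A := by
  induction n, hmn using Nat.le_induction generalizing K with
  | base => exact ⟨K, hK, hA⟩
  | succ n hn ih =>
    obtain ⟨K', hK', hA'⟩ := exists_res_isGorenstein_of_succ hP horth hK hA
      fun C hC i hi => hext C hC i (by omega)
    exact ih hK' hA'

end RelHomDim

open RelHomDim in
/-- Theorem 3.14. -/
theorem stmt16 {𝒜 : Type u} [Category.{v} 𝒜] [Abelian 𝒜] [HasExt.{w} 𝒜]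
    (𝒞 : 𝒜 → Prop) (h𝒞 : IsAdditiveClass 𝒞)
    (horth : ∀ C₁ C₂ : 𝒜, 𝒞 C₁ → 𝒞 C₂ → ∀ i : ℕ, 1 ≤ i →
      Subsingleton (Abelian.Ext C₁ C₂ i))
    (A : 𝒜) (hA : rdim (IsGorenstein 𝒞) A < ⊤) :
    rdim (IsGorenstein 𝒞) A = rdim (MemLeftPerp 𝒞) A := by
  have hle : ∀ X, IsGorenstein 𝒞 X → MemLeftPerp 𝒞 X := fun X hX =>
    (isBiresolved_isGorenstein horth).memLeftPerp horth hX
  apply le_antisymm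
  · obtain ⟨_, ⟨n, rfl, K, hK, hn⟩, -⟩ := sInf_lt_iff.1 hA
    refine le_sInf ?_
    rintro _ ⟨m, rfl, L, hL, hm⟩
    rcases le_total m n with hmn | hnm
    · obtain ⟨K', hK', hR⟩ := exists_res_isGorenstein_of_le h𝒞 horth hmn hK hn
        fun C hC i hi => subsingleton_ext_of_res_memLeftPerp hL hm hC hi
      exact sInf_le ⟨m, rfl, K', hK', hR⟩
    · exact sInf_le_of_le ⟨n, rfl, K, hK, hn⟩ (by exact_mod_cast hnm)
  · refine sInf_le_sInf ?_
    rintro _ ⟨n, rfl, K, hK, hn⟩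
    exact ⟨n, rfl, K, hle K hK, hn.mono hle⟩
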